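/- Optimized adaptive bound. Fix an interval I = [r,s] with 1 ≤ r ≤ s ≤ T, let S = Σ_{t=r}^{s} ⟨q^(t), (ℓ^(t))²⟩ and suppose S > 0. Take γ = 1/(2|I|) and η = √((log(|L|·2|I|) + 1)/S), and assume η ≤ 1 and γ ≤ 1/2. If the mixture losses are nonpositive on I, i.e., Σ_{t=r}^{s} ⟨q^(t), ℓ^(t)⟩ ≤ 0, then max_{i∈L} (1/|I|)·Σ_{t=r}^{s} ℓ^(t)_i ≤ (2/|I|)·√((log(|L|·2|I|) + 1)·S); in particular, since S ≤ |I|, the left-hand side is at most 2·√((log(|L|·2|I|) + 1)/|I|). -/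

import Mathlib

open Finset in
/-- A Fixed Share update of a positive weight vector has total mass one. -/
theorem fixedShare_sum_eq_one {L : Type*} [Fintype L] [Nonempty L] {η γ : ℝ} {p p' x : L → ℝ}
    (hp : ∀ i, 0 < p i)
    (h : ∀ i, p' i = (1 - γ) * p i * Real.exp (η * x i) / (∑ j, p j * Real.exp (η * x j))
      + γ / (Fintype.card L : ℝ)) :
    ∑ i, p' i = 1 := by
  have hZ : 0 < ∑ j, p j * Real.exp (η * x j) :=
    sum_pos (fun j _ => mul_pos (hp j) (Real.exp_pos _)) univ_nonempty
  have hL : (Fintype.card L : ℝ) ≠ 0 := by exact_mod_cast Fintype.card_ne_zero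
  simp only [h, sum_add_distrib, ← sum_div, mul_assoc, ← mul_sum, sum_const, card_univ,
    nsmul_eq_mul]
  field_simp
  ring

open Finset in
/-- The mixture loss is bounded by its mean plus its second moment. -/
theorem log_sum_mul_exp_le {L : Type*} [Fintype L] [Nonempty L] {η : ℝ} {p x : L → ℝ}
    (hp : ∀ i, 0 < p i) (hsum : ∑ i, p i = 1) (hη0 : 0 ≤ η) (hη1 : η ≤ 1)
    (hx : ∀ i, x i ∈ Set.Icc (-1 : ℝ) 1) :
    Real.log (∑ j, p j * Real.exp (η * x j))
      ≤ η * ∑ i, p i * x i + η ^ 2 * ∑ i, p i * x i ^ 2 := by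
  have hZ : 0 < ∑ j, p j * Real.exp (η * x j) :=
    sum_pos (fun j _ => mul_pos (hp j) (Real.exp_pos _)) univ_nonempty
  have hexp : ∑ j, p j * Real.exp (η * x j)
      ≤ ∑ j, p j * (1 + η * x j + (η * x j) ^ 2) := by
    refine sum_le_sum fun j _ => mul_le_mul_of_nonneg_left ?_ (hp j).le
    have habs : |η * x j| ≤ 1 := by
      rw [abs_mul, abs_of_nonneg hη0]
      exact mul_le_one₀ hη1 (abs_nonneg _) (abs_le.2 (hx j))
    have := (abs_le.1 (Real.abs_exp_sub_one_sub_id_le habs)).2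
    linarith
  have hexpand : ∑ j, p j * (1 + η * x j + (η * x j) ^ 2)
      = 1 + (η * ∑ i, p i * x i + η ^ 2 * ∑ i, p i * x i ^ 2) := by
    conv_rhs => rw [← hsum, mul_sum, mul_sum, ← sum_add_distrib, ← sum_add_distrib]
    exact sum_congr rfl fun j _ => by ring
  linarith [Real.log_le_sub_one_of_pos hZ]

open Finset in
/-- One Fixed Share update increases the log-weight of a coordinate by at least its scaled loss
minus the mixture loss, up to the mixing cost `log (1 - γ)`. -/
theorem log_fixedShare_ge {L : Type*} [Fintype L] [Nonempty L] {η γ : ℝ} {p p' x : L → ℝ}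
    (hp : ∀ i, 0 < p i) (hγ0 : 0 ≤ γ) (hγ1 : γ < 1)
    (h : ∀ i, p' i = (1 - γ) * p i * Real.exp (η * x i) / (∑ j, p j * Real.exp (η * x j))
      + γ / (Fintype.card L : ℝ)) (i : L) :
    Real.log (1 - γ) + Real.log (p i) + η * x i - Real.log (∑ j, p j * Real.exp (η * x j))
      ≤ Real.log (p' i) := by
  have hZ : 0 < ∑ j, p j * Real.exp (η * x j) :=
    sum_pos (fun j _ => mul_pos (hp j) (Real.exp_pos _)) univ_nonempty
  have hγ : 0 < 1 - γ := by linarith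
  have hnum : 0 < (1 - γ) * p i := mul_pos hγ (hp i)
  calc _ = Real.log ((1 - γ) * p i * Real.exp (η * x i) / ∑ j, p j * Real.exp (η * x j)) := by
        rw [Real.log_div (by positivity) hZ.ne', Real.log_mul hnum.ne' (Real.exp_pos _).ne',
          Real.log_mul hγ.ne' (hp i).ne', Real.log_exp]
    _ ≤ Real.log (p' i) := by
        refine Real.log_le_log (by positivity) ?_
        rw [h i]
        exact le_add_of_nonneg_right (by positivity)

/-- Fixed Share weights stay above the uniform share `γ / |L|` and have total mass one. -/
theorem fixedShare_weights {L : Type*} [Fintype L] [Nonempty L] {T : ℕ} {η γ : ℝ}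
    {q ℓ : ℕ → L → ℝ} (hγ0 : 0 < γ) (hγ1 : γ ≤ 1)
    (hq1 : ∀ i, q 1 i = 1 / (Fintype.card L : ℝ))
    (hqrec : ∀ t ∈ Finset.Icc 1 T, ∀ i,
      q (t + 1) i = (1 - γ) * q t i * Real.exp (η * ℓ t i) /
          (∑ j, q t j * Real.exp (η * ℓ t j)) + γ / (Fintype.card L : ℝ))
    {t : ℕ} (ht : 1 ≤ t) (htT : t ≤ T + 1) :
    (∀ i, γ / (Fintype.card L : ℝ) ≤ q t i) ∧ ∑ i, q t i = 1 := by
  have hL : (0 : ℝ) < Fintype.card L := by exact_mod_cast Fintype.card_pos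
  induction t, ht using Nat.le_induction with
  | base =>
    refine ⟨fun i => ?_, ?_⟩
    · rw [hq1]; gcongr
    · simp [hq1]
  | succ t ht ih =>
    obtain ⟨hlow, -⟩ := ih (by omega)
    have hpos : ∀ i, 0 < q t i := fun i => (div_pos hγ0 hL).trans_le (hlow i)
    have hrec := hqrec t (Finset.mem_Icc.2 ⟨ht, by omega⟩)
    refine ⟨fun i => ?_, fixedShare_sum_eq_one hpos hrec⟩
    rw [hrec i]
    refine le_add_of_nonneg_left (div_nonneg (mul_nonneg (mul_nonneg ?_ (hpos i).le)
      (Real.exp_pos _).le) (Finset.sum_nonneg fun j _ => mul_nonneg (hpos j).le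
        (Real.exp_pos _).le))
    linarith

/-- Adaptive second-order regret bound for Fixed Share on the interval `[r, s]`. -/
theorem fixedShare_adaptive_regret {L : Type*} [Fintype L] [Nonempty L] {T r s : ℕ} {η γ : ℝ}
    {q ℓ : ℕ → L → ℝ} (hℓ : ∀ t ∈ Finset.Icc 1 T, ∀ i, ℓ t i ∈ Set.Icc (-1 : ℝ) 1)
    (hr : 1 ≤ r) (hrs : r ≤ s) (hsT : s ≤ T) (hη0 : 0 ≤ η) (hη1 : η ≤ 1)
    (hγ0 : 0 < γ) (hγ1 : γ < 1)
    (hq1 : ∀ i, q 1 i = 1 / (Fintype.card L : ℝ))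
    (hqrec : ∀ t ∈ Finset.Icc 1 T, ∀ i,
      q (t + 1) i = (1 - γ) * q t i * Real.exp (η * ℓ t i) /
          (∑ j, q t j * Real.exp (η * ℓ t j)) + γ / (Fintype.card L : ℝ)) (i : L) :
    η * ∑ t ∈ Finset.Icc r s, ℓ t i
      ≤ η * ∑ t ∈ Finset.Icc r s, ∑ i, q t i * ℓ t i
        + η ^ 2 * ∑ t ∈ Finset.Icc r s, ∑ i, q t i * ℓ t i ^ 2
        + Real.log (Fintype.card L / γ) - ((s : ℝ) - r + 1) * Real.log (1 - γ) := by
  have hL : (0 : ℝ) < Fintype.card L := by exact_mod_cast Fintype.card_pos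
  have hw {t : ℕ} (ht : 1 ≤ t) (htT : t ≤ T + 1) :=
    fixedShare_weights hγ0 hγ1.le hq1 hqrec ht htT
  have hpos {t : ℕ} (ht : 1 ≤ t) (htT : t ≤ T + 1) (j : L) : 0 < q t j :=
    (div_pos hγ0 hL).trans_le ((hw ht htT).1 j)
  have hsum : ∑ t ∈ Finset.Icc r s, (Real.log (1 - γ) + η * ℓ t i
      - (η * ∑ i, q t i * ℓ t i + η ^ 2 * ∑ i, q t i * ℓ t i ^ 2))
      ≤ ∑ t ∈ Finset.Icc r s, (Real.log (q (t + 1) i) - Real.log (q t i)) := by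
    refine Finset.sum_le_sum fun t ht => ?_
    obtain ⟨hrt, hts⟩ := Finset.mem_Icc.1 ht
    have ht' : t ∈ Finset.Icc 1 T := Finset.mem_Icc.2 ⟨by omega, by omega⟩
    have hp := hpos (t := t) (by omega) (by omega)
    have h1 := log_fixedShare_ge hp hγ0.le hγ1 (hqrec t ht') i
    have h2 := log_sum_mul_exp_le hp (hw (by omega) (by omega)).2 hη0 hη1 (hℓ t ht')
    linarith
  rw [← Finset.Ico_add_one_right_eq_Icc,
    Finset.sum_Ico_sub (fun t => Real.log (q t i)) (by omega)] at hsum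
  simp only [Finset.sum_sub_distrib, Finset.sum_add_distrib, ← Finset.mul_sum, Finset.sum_const,
    Nat.card_Icc, nsmul_eq_mul, Finset.Ico_add_one_right_eq_Icc] at hsum
  have hcard : ((s + 1 - r : ℕ) : ℝ) = (s : ℝ) - r + 1 := by
    rw [Nat.cast_sub (by omega)]; push_cast; ring
  rw [hcard] at hsum
  have hend : Real.log (q (s + 1) i) ≤ 0 := by
    refine Real.log_nonpos (hpos (by omega) (by omega) i).le ?_
    rw [← (hw (t := s + 1) (by omega) (by omega)).2]
    exact Finset.single_le_sum (fun j _ => (hpos (by omega) (by omega) j).le) (Finset.mem_univ i)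
  have hstart : -Real.log (Fintype.card L / γ) ≤ Real.log (q r i) := by
    rw [← Real.log_inv, inv_div]
    exact Real.log_le_log (div_pos hγ0 hL) ((hw hr (by omega)).1 i)
  linarith


/-- **Optimized adaptive bound.**
Fix an interval `I = [r,s]` with `1 ≤ r ≤ s ≤ T`, let `S = Σ_{t=r}^{s} ⟨q^(t), (ℓ^(t))²⟩ > 0`.
Take `γ = 1/(2|I|)` and `η = √((log(|L|·2|I|) + 1)/S)`, and assume `η ≤ 1`, `γ ≤ 1/2`.
If `Σ_{t=r}^{s} ⟨q^(t), ℓ^(t)⟩ ≤ 0`, then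
`max_i (1/|I|)·Σ_{t=r}^{s} ℓ^(t)_i ≤ (2/|I|)·√((log(|L|·2|I|)+1)·S)`; in particular, since
`S ≤ |I|`, it is at most `2·√((log(|L|·2|I|)+1)/|I|)`. -/
theorem optimized_adaptive_bound
    {L : Type*} [Fintype L] [Nonempty L]
    (T : ℕ) (hT : 1 ≤ T)
    (ℓ : ℕ → L → ℝ)
    (hℓ : ∀ t ∈ Finset.Icc 1 T, ∀ i, ℓ t i ∈ Set.Icc (-1 : ℝ) 1)
    (r s : ℕ) (hr : 1 ≤ r) (hrs : r ≤ s) (hsT : s ≤ T)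
    (η γ : ℝ)
    (q : ℕ → L → ℝ)
    (hq1 : ∀ i, q 1 i = 1 / (Fintype.card L : ℝ))
    (hqrec : ∀ t ∈ Finset.Icc 1 T, ∀ i,
      q (t + 1) i = (1 - γ) * q t i * Real.exp (η * ℓ t i) /
          (∑ j, q t j * Real.exp (η * ℓ t j)) + γ / (Fintype.card L : ℝ))
    (hS : 0 < ∑ t ∈ Finset.Icc r s, ∑ i, q t i * (ℓ t i) ^ 2)
    (hγdef : γ = 1 / (2 * ((s : ℝ) - r + 1)))
    (hηdef : η = Real.sqrt
      ((Real.log ((Fintype.card L : ℝ) * (2 * ((s : ℝ) - r + 1))) + 1) /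
        (∑ t ∈ Finset.Icc r s, ∑ i, q t i * (ℓ t i) ^ 2)))
    (hη1 : η ≤ 1) (hγ2 : γ ≤ 1 / 2)
    (hmix : ∑ t ∈ Finset.Icc r s, ∑ i, q t i * ℓ t i ≤ 0) :
    (Finset.univ.sup' Finset.univ_nonempty fun i =>
        (1 / ((s : ℝ) - r + 1)) * ∑ t ∈ Finset.Icc r s, ℓ t i)
      ≤ (2 / ((s : ℝ) - r + 1)) * Real.sqrt
          ((Real.log ((Fintype.card L : ℝ) * (2 * ((s : ℝ) - r + 1))) + 1) *
            (∑ t ∈ Finset.Icc r s, ∑ i, q t i * (ℓ t i) ^ 2)) ∧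
    (Finset.univ.sup' Finset.univ_nonempty fun i =>
        (1 / ((s : ℝ) - r + 1)) * ∑ t ∈ Finset.Icc r s, ℓ t i)
      ≤ 2 * Real.sqrt
          ((Real.log ((Fintype.card L : ℝ) * (2 * ((s : ℝ) - r + 1))) + 1) /
            ((s : ℝ) - r + 1)) := by
  set n : ℝ := (s : ℝ) - r + 1 with hn
  set S : ℝ := ∑ t ∈ Finset.Icc r s, ∑ i, q t i * (ℓ t i) ^ 2 with hSdef
  set A : ℝ := Real.log ((Fintype.card L : ℝ) * (2 * n)) + 1 with hA
  have hn1 : 1 ≤ n := by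
    have : (r : ℝ) ≤ s := by exact_mod_cast hrs
    linarith
  have hn0 : 0 < n := by linarith
  have hL1 : (1 : ℝ) ≤ Fintype.card L := by exact_mod_cast Fintype.card_pos
  have hA0 : 0 < A := by
    have : 0 ≤ Real.log ((Fintype.card L : ℝ) * (2 * n)) := Real.log_nonneg (by nlinarith)
    linarith
  have hγ0 : 0 < γ := by rw [hγdef]; positivity
  have hη0 : 0 < η := by rw [hηdef]; exact Real.sqrt_pos.2 (div_pos hA0 hS)
  have hηS : η * S = Real.sqrt (A * S) := by
    rw [hηdef, Real.sqrt_div hA0.le, Real.sqrt_mul hA0.le]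
    nth_rw 2 [← Real.mul_self_sqrt hS.le]
    field_simp
  have hη2 : η ^ 2 * S = A := by
    rw [hηdef, Real.sq_sqrt (div_pos hA0 hS).le]
    field_simp
  have hmixing : -1 ≤ n * Real.log (1 - γ) := by
    have hlog := Real.one_sub_inv_le_log_of_pos (show 0 < 1 - γ by linarith)
    have hinv : (1 - γ)⁻¹ ≤ 1 + 2 * γ := by
      rw [inv_le_iff_one_le_mul₀ (by linarith)]
      nlinarith
    have hnγ : n * (2 * γ) = 1 := by rw [hγdef]; field_simp
    nlinarith
  have hregret (i : L) : ∑ t ∈ Finset.Icc r s, ℓ t i ≤ 2 * Real.sqrt (A * S) := by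
    have h := fixedShare_adaptive_regret hℓ hr hrs hsT hη0.le hη1 hγ0 (by linarith) hq1 hqrec i
    have hγlog : (Fintype.card L : ℝ) / γ = Fintype.card L * (2 * n) := by
      rw [hγdef]; field_simp
    rw [hγlog, ← hn, ← hSdef] at h
    have hmix' := mul_nonpos_of_nonneg_of_nonpos hη0.le hmix
    refine le_of_mul_le_mul_left ?_ hη0
    have : η * (2 * Real.sqrt (A * S)) = 2 * A := by rw [← hηS, ← hη2]; ring
    linarith
  have hSn : S ≤ n := by
    calc S ≤ ∑ t ∈ Finset.Icc r s, (1 : ℝ) := by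
          refine Finset.sum_le_sum fun t ht => ?_
          obtain ⟨hrt, hts⟩ := Finset.mem_Icc.1 ht
          obtain ⟨hlow, hsum⟩ := fixedShare_weights hγ0 (by linarith) hq1 hqrec
            (t := t) (by omega) (by omega)
          rw [← hsum]
          refine Finset.sum_le_sum fun i _ => mul_le_of_le_one_right ?_ ?_
          · exact (by positivity : 0 ≤ γ / (Fintype.card L : ℝ)).trans (hlow i)
          · have := hℓ t (Finset.mem_Icc.2 ⟨by omega, by omega⟩) i
            exact (sq_le_one_iff_abs_le_one _).2 (abs_le.2 this)
      _ = n := by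
          rw [Finset.sum_const, Nat.card_Icc, nsmul_eq_mul, Nat.cast_sub (by omega)]
          push_cast
          rw [hn]; ring
  have hfirst : (Finset.univ.sup' Finset.univ_nonempty fun i =>
      (1 / n) * ∑ t ∈ Finset.Icc r s, ℓ t i) ≤ (2 / n) * Real.sqrt (A * S) := by
    refine Finset.sup'_le _ _ fun i _ => ?_
    calc (1 / n) * ∑ t ∈ Finset.Icc r s, ℓ t i ≤ (1 / n) * (2 * Real.sqrt (A * S)) := by
          gcongr; exact hregret i
      _ = (2 / n) * Real.sqrt (A * S) := by ring
  refine ⟨hfirst, hfirst.trans ?_⟩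
  calc (2 / n) * Real.sqrt (A * S) ≤ (2 / n) * Real.sqrt (A / n * n ^ 2) := by
        have : A / n * n ^ 2 = A * n := by field_simp
        rw [this]; gcongr
    _ = 2 * Real.sqrt (A / n) := by
        rw [Real.sqrt_mul (by positivity), Real.sqrt_sq hn0.le]
        field_simp
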